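/- arXiv:2108.02908 — 2 statements merged into one kernel-verified Lean document; each statement's English description precedes it below -/
import Mathlib

section
/- Let X and Y be real Banach spaces and Z = X ⊕_1 Y (the product X × Y with norm ‖(x,y)‖ = ‖x‖ + ‖y‖). If Z has the Ball Small Combination of Slices Property (BSCSP), then X has BSCSP or Y has BSCSP. -/
open Metric Topology Pointwise ENNReal

noncomputable section

/-- The slice `S(B_X, f, α) = {x ∈ B_X : f x > 1 - α}` of the closed unit ball of `X`
determined by the functional `f` and `α`. -/
def ballSlice (X : Type*) [NormedAddCommGroup X] [NormedSpace ℝ X]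
    (f : X →L[ℝ] ℝ) (α : ℝ) : Set X :=
  {x | x ∈ closedBall (0 : X) 1 ∧ 1 - α < f x}

/-- `X` has the Ball Dentable Property: the closed unit ball has slices (determined by
norm-one functionals) of arbitrarily small diameter. -/
def BDP (X : Type*) [NormedAddCommGroup X] [NormedSpace ℝ X] : Prop :=
  ∀ ε > (0 : ℝ), ∃ f : X →L[ℝ] ℝ, ‖f‖ = 1 ∧ ∃ α > (0 : ℝ), diam (ballSlice X f α) < ε

/-- The weak topology on `X`: the coarsest topology making all continuous linear
functionals continuous. -/
def weakTop (X : Type*) [NormedAddCommGroup X] [NormedSpace ℝ X] : TopologicalSpace X :=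
  ⨅ f : X →L[ℝ] ℝ, TopologicalSpace.induced f inferInstance

/-- `X` has the Ball Huskable Property: the closed unit ball has nonempty relatively
weakly open subsets of arbitrarily small diameter. -/
def BHP (X : Type*) [NormedAddCommGroup X] [NormedSpace ℝ X] : Prop :=
  ∀ ε > (0 : ℝ), ∃ V : Set X, IsOpen[weakTop X] V ∧
    (V ∩ closedBall (0 : X) 1).Nonempty ∧ diam (V ∩ closedBall (0 : X) 1) < ε

/-- `X` has the Ball Small Combination of Slices Property: there are finite convex
combinations of slices of the closed unit ball of arbitrarily small diameter. -/
def BSCSP (X : Type*) [NormedAddCommGroup X] [NormedSpace ℝ X] : Prop :=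
  ∀ ε > (0 : ℝ), ∃ (n : ℕ) (f : Fin n → X →L[ℝ] ℝ) (α lam : Fin n → ℝ),
    (∀ i, ‖f i‖ = 1) ∧ (∀ i, 0 < α i) ∧ (∀ i, 0 ≤ lam i) ∧ (∑ i, lam i = 1) ∧
    diam (∑ i, lam i • ballSlice X (f i) (α i)) < ε

/-- The weak* ballSlice `{g ∈ B_{E*} : g e > 1 - α}` of the closed unit ball of the dual of `E`
determined by `e : E` and `α`. -/
def wstarSlice (E : Type*) [NormedAddCommGroup E] [NormedSpace ℝ E]
    (e : E) (α : ℝ) : Set (E →L[ℝ] ℝ) :=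
  {g | g ∈ closedBall (0 : E →L[ℝ] ℝ) 1 ∧ 1 - α < g e}

/-- The dual of `E` has the w*-Ball Dentable Property: the closed unit ball of `E*` has
weak* slices (determined by norm-one elements of `E`) of arbitrarily small diameter. -/
def wstarBDP (E : Type*) [NormedAddCommGroup E] [NormedSpace ℝ E] : Prop :=
  ∀ ε > (0 : ℝ), ∃ e : E, ‖e‖ = 1 ∧ ∃ α > (0 : ℝ), diam (wstarSlice E e α) < ε

/-- The weak* topology `σ(E*, E)` on the dual of `E`. -/
def wstarTop (E : Type*) [NormedAddCommGroup E] [NormedSpace ℝ E] :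
    TopologicalSpace (E →L[ℝ] ℝ) :=
  ⨅ e : E, TopologicalSpace.induced (fun g : E →L[ℝ] ℝ => g e) inferInstance

/-- The dual of `E` has the w*-Ball Huskable Property: the closed unit ball of `E*` has
nonempty relatively weak*-open subsets of arbitrarily small diameter. -/
def wstarBHP (E : Type*) [NormedAddCommGroup E] [NormedSpace ℝ E] : Prop :=
  ∀ ε > (0 : ℝ), ∃ V : Set (E →L[ℝ] ℝ), IsOpen[wstarTop E] V ∧
    (V ∩ closedBall (0 : E →L[ℝ] ℝ) 1).Nonempty ∧
    diam (V ∩ closedBall (0 : E →L[ℝ] ℝ) 1) < ε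

/-- The dual of `E` has the w*-Ball Small Combination of Slices Property: there are finite
convex combinations of weak* slices of the closed unit ball of `E*` of arbitrarily small
diameter. -/
def wstarBSCSP (E : Type*) [NormedAddCommGroup E] [NormedSpace ℝ E] : Prop :=
  ∀ ε > (0 : ℝ), ∃ (n : ℕ) (e : Fin n → E) (α lam : Fin n → ℝ),
    (∀ i, ‖e i‖ = 1) ∧ (∀ i, 0 < α i) ∧ (∀ i, 0 ≤ lam i) ∧ (∑ i, lam i = 1) ∧
    diam (∑ i, lam i • wstarSlice E (e i) (α i)) < ε

lemma ballSlice_nonempty {X : Type*} [NormedAddCommGroup X] [NormedSpace ℝ X]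
    {f : X →L[ℝ] ℝ} (hf : ‖f‖ = 1) {α : ℝ} (hα : 0 < α) : (ballSlice X f α).Nonempty := by
  obtain ⟨x, hx, hfx⟩ := f.exists_lt_apply_of_lt_opNorm (r := 1 - α) (by linarith)
  rw [Real.norm_eq_abs] at hfx
  rcases lt_abs.1 hfx with h | h
  · exact ⟨x, by simpa using hx.le, h⟩
  · exact ⟨-x, by simpa using hx.le, by simpa using h⟩

lemma mem_sum_smul_ballSlice {X : Type*} [NormedAddCommGroup X] [NormedSpace ℝ X] {n : ℕ}
    {f : Fin n → X →L[ℝ] ℝ} {α lam : Fin n → ℝ} {z : X} :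
    z ∈ ∑ i, lam i • ballSlice X (f i) (α i) ↔
      ∃ x : Fin n → X, (∀ i, x i ∈ ballSlice X (f i) (α i)) ∧ ∑ i, lam i • x i = z := by
  rw [Set.mem_fintype_sum]
  constructor
  · rintro ⟨g, hg, rfl⟩
    choose x hx hxg using fun i => Set.mem_smul_set.1 (hg i)
    exact ⟨x, hx, by simp only [hxg]⟩
  · rintro ⟨x, hx, rfl⟩
    exact ⟨fun i => lam i • x i, fun i => Set.smul_mem_smul_set (hx i), rfl⟩

lemma isBounded_sum_smul_ballSlice {X : Type*} [NormedAddCommGroup X] [NormedSpace ℝ X] {n : ℕ}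
    (f : Fin n → X →L[ℝ] ℝ) (α lam : Fin n → ℝ) :
    Bornology.IsBounded (∑ i, lam i • ballSlice X (f i) (α i)) := by
  refine isBounded_closedBall.subset (t := closedBall 0 (∑ i, ‖lam i‖)) fun z hz => ?_
  obtain ⟨x, hx, rfl⟩ := mem_sum_smul_ballSlice.1 hz
  rw [mem_closedBall_zero_iff]
  refine norm_sum_le_of_le _ fun i _ => ?_
  rw [norm_smul]
  exact mul_le_of_le_one_right (norm_nonneg _) (mem_closedBall_zero_iff.1 (hx i).1)

/-- If slices of the ball of `Z` whose functionals restrict to norm-one functionals on an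
isometric copy of `X` carry at least half of the weight of a combination of slices of diameter
less than `ε / 2`, then the ball of `X` has a combination of slices of diameter less than `ε`. -/
lemma exists_diam_sum_smul_ballSlice_lt {X Z : Type*} [NormedAddCommGroup X] [NormedSpace ℝ X]
    [NormedAddCommGroup Z] [NormedSpace ℝ Z] (T : X →ₗᵢ[ℝ] Z) {n : ℕ}
    {f : Fin n → Z →L[ℝ] ℝ} {α lam : Fin n → ℝ} (hf : ∀ i, ‖f i‖ = 1) (hα : ∀ i, 0 < α i)
    (hlam : ∀ i, 0 ≤ lam i) {ε : ℝ}
    (hε : diam (∑ i, lam i • ballSlice Z (f i) (α i)) < ε / 2) (I : Finset (Fin n))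
    (hI : ∀ i ∈ I, ‖(f i).comp T.toContinuousLinearMap‖ = 1) (hI_sum : 1 / 2 ≤ ∑ i ∈ I, lam i) :
    ∃ (n : ℕ) (f : Fin n → X →L[ℝ] ℝ) (α lam : Fin n → ℝ),
      (∀ i, ‖f i‖ = 1) ∧ (∀ i, 0 < α i) ∧ (∀ i, 0 ≤ lam i) ∧ (∑ i, lam i = 1) ∧
      diam (∑ i, lam i • ballSlice X (f i) (α i)) < ε := by
  set c := ∑ i ∈ I, lam i with hc
  have c_pos : 0 < c := by linarith
  obtain ⟨i₀, hi₀⟩ : I.Nonempty := by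
    rw [Finset.nonempty_iff_ne_empty]
    rintro rfl
    simp [hc] at c_pos
  choose w hw using fun i => ballSlice_nonempty (hf i) (hα i)
  set d := diam (∑ i, lam i • ballSlice Z (f i) (α i)) with hd
  have d_nonneg : 0 ≤ d := diam_nonneg
  refine ⟨n, fun i => (f (if i ∈ I then i else i₀)).comp T.toContinuousLinearMap, α,
    fun i => if i ∈ I then c⁻¹ * lam i else 0, fun i => hI _ ?_, hα, fun i => ?_, ?_, ?_⟩
  · split_ifs with h
    exacts [h, hi₀]
  · have := hlam i
    dsimp only
    split_ifs <;> positivity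
  · rw [Finset.sum_ite_mem, Finset.univ_inter, ← Finset.mul_sum, ← hc, inv_mul_cancel₀ c_pos.ne']
  · refine (diam_le_of_forall_dist_le (C := 2 * d) (by positivity) fun x hx y hy => ?_).trans_lt
      (by linarith)
    obtain ⟨x, x_mem, rfl⟩ := mem_sum_smul_ballSlice.1 hx
    obtain ⟨y, y_mem, rfl⟩ := mem_sum_smul_ballSlice.1 hy
    have lift_mem (u : Fin n → X) (hu : ∀ i, u i ∈ ballSlice X
        ((f (if i ∈ I then i else i₀)).comp T.toContinuousLinearMap) (α i)) :
        ∑ i, lam i • (if i ∈ I then T (u i) else w i) ∈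
          ∑ i, lam i • ballSlice Z (f i) (α i) := by
      refine mem_sum_smul_ballSlice.2 ⟨_, fun i => ?_, rfl⟩
      have hui := hu i
      split_ifs with h
      · simpa [ballSlice, h] using hui
      · exact hw i
    have key := dist_le_diam_of_mem (isBounded_sum_smul_ballSlice f α lam)
      (lift_mem x x_mem) (lift_mem y y_mem)
    have lift_sub : ∑ i, lam i • (if i ∈ I then T (x i) else w i) -
        ∑ i, lam i • (if i ∈ I then T (y i) else w i) =
        T (c • (∑ i, (if i ∈ I then c⁻¹ * lam i else 0) • x i -
          ∑ i, (if i ∈ I then c⁻¹ * lam i else 0) • y i)) := by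
      rw [← Finset.sum_sub_distrib, ← Finset.sum_sub_distrib, Finset.smul_sum, map_sum]
      refine Finset.sum_congr rfl fun i _ => ?_
      split_ifs
      · rw [← smul_sub, ← smul_sub, smul_smul, mul_inv_cancel_left₀ c_pos.ne', map_smul, map_sub]
      · simp
    rw [dist_eq_norm, lift_sub, T.norm_map, norm_smul, Real.norm_of_nonneg c_pos.le, ← hd] at key
    rw [dist_eq_norm]
    nlinarith [norm_nonneg (∑ i, (if i ∈ I then c⁻¹ * lam i else 0) • x i -
      ∑ i, (if i ∈ I then c⁻¹ * lam i else 0) • y i)]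

/-- The isometric inclusion of `X` into `X ⊕_1 Y`. -/
def inlL1 (X Y : Type*) [NormedAddCommGroup X] [NormedSpace ℝ X]
    [NormedAddCommGroup Y] [NormedSpace ℝ Y] : X →ₗᵢ[ℝ] WithLp 1 (X × Y) where
  toLinearMap := (WithLp.linearEquiv 1 ℝ (X × Y)).symm.toLinearMap ∘ₗ LinearMap.inl ℝ X Y
  norm_map' x := WithLp.norm_toLp_fst 1 X Y x

/-- The isometric inclusion of `Y` into `X ⊕_1 Y`. -/
def inrL1 (X Y : Type*) [NormedAddCommGroup X] [NormedSpace ℝ X]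
    [NormedAddCommGroup Y] [NormedSpace ℝ Y] : Y →ₗᵢ[ℝ] WithLp 1 (X × Y) where
  toLinearMap := (WithLp.linearEquiv 1 ℝ (X × Y)).symm.toLinearMap ∘ₗ LinearMap.inr ℝ X Y
  norm_map' y := WithLp.norm_toLp_snd 1 X Y y

lemma norm_comp_inlL1_or_inrL1_eq_norm {X Y : Type*} [NormedAddCommGroup X] [NormedSpace ℝ X]
    [NormedAddCommGroup Y] [NormedSpace ℝ Y] (h : WithLp 1 (X × Y) →L[ℝ] ℝ) :
    ‖h.comp (inlL1 X Y).toContinuousLinearMap‖ = ‖h‖ ∨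
      ‖h.comp (inrL1 X Y).toContinuousLinearMap‖ = ‖h‖ := by
  set f := h.comp (inlL1 X Y).toContinuousLinearMap
  set g := h.comp (inrL1 X Y).toContinuousLinearMap
  have hf : ‖f‖ ≤ ‖h‖ := ContinuousLinearMap.opNorm_le_bound _ (norm_nonneg _) fun x =>
    (h.le_opNorm _).trans_eq (by simp)
  have hg : ‖g‖ ≤ ‖h‖ := ContinuousLinearMap.opNorm_le_bound _ (norm_nonneg _) fun y =>
    (h.le_opNorm _).trans_eq (by simp)
  have hmax : ‖h‖ ≤ max ‖f‖ ‖g‖ := by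
    refine ContinuousLinearMap.opNorm_le_bound _ (by positivity) fun z => ?_
    have decomp : z = inlL1 X Y z.fst + inrL1 X Y z.snd := by
      refine WithLp.ofLp_injective 1 ?_
      change z.ofLp = (z.fst, 0) + (0, z.snd)
      simp [Prod.ext_iff]
    calc ‖h z‖ = ‖f z.fst + g z.snd‖ := by
          conv_lhs => rw [decomp, map_add]
          rfl
      _ ≤ ‖f‖ * ‖z.fst‖ + ‖g‖ * ‖z.snd‖ :=
          norm_add_le_of_le (f.le_opNorm _) (g.le_opNorm _)
      _ ≤ max ‖f‖ ‖g‖ * ‖z.fst‖ + max ‖f‖ ‖g‖ * ‖z.snd‖ := by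
          gcongr
          exacts [le_max_left _ _, le_max_right _ _]
      _ = max ‖f‖ ‖g‖ * ‖z‖ := by rw [WithLp.prod_norm_eq_of_L1, mul_add]
  rcases le_max_iff.1 hmax with H | H
  · exact .inl (hf.antisymm H)
  · exact .inr (hg.antisymm H)

/-- If `Z = X ⊕_1 Y` has `BSCSP`, then `X` or `Y` has `BSCSP`. -/
theorem statement10 (X Y : Type*) [NormedAddCommGroup X] [NormedSpace ℝ X] [CompleteSpace X]
    [NormedAddCommGroup Y] [NormedSpace ℝ Y] [CompleteSpace Y]
    (h : BSCSP (WithLp 1 (X × Y))) :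
    BSCSP X ∨ BSCSP Y := by
  by_contra! hXY
  obtain ⟨hX, hY⟩ := hXY
  unfold BSCSP at hX hY
  push Not at hX hY
  obtain ⟨a, ha, hX⟩ := hX
  obtain ⟨b, hb, hY⟩ := hY
  have hab : 0 < min a b := lt_min ha hb
  obtain ⟨n, f, α, lam, hf, hα, hlam, hsum, hdiam⟩ := h (min a b / 2) (by positivity)
  set I := Finset.univ.filter fun i => ‖(f i).comp (inlL1 X Y).toContinuousLinearMap‖ = 1 with hI
  have hsplit : ∑ i ∈ I, lam i + ∑ i ∈ Iᶜ, lam i = 1 := by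
    rw [Finset.sum_add_sum_compl, hsum]
  rcases le_total (1 / 2) (∑ i ∈ I, lam i) with H | H
  · obtain ⟨m, f', α', lam', h1, h2, h3, h4, h5⟩ :=
      exists_diam_sum_smul_ballSlice_lt (inlL1 X Y) hf hα hlam hdiam I (by simp [hI]) H
    exact (hX m f' α' lam' h1 h2 h3 h4).not_gt (h5.trans_le (min_le_left _ _))
  · have hIc : ∀ i ∈ Iᶜ, ‖(f i).comp (inrL1 X Y).toContinuousLinearMap‖ = 1 := by
      intro i hi
      have hi' : ‖(f i).comp (inlL1 X Y).toContinuousLinearMap‖ ≠ 1 := by simpa [hI] using hi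
      rw [← hf i] at hi' ⊢
      exact (norm_comp_inlL1_or_inrL1_eq_norm (f i)).resolve_left hi'
    obtain ⟨m, f', α', lam', h1, h2, h3, h4, h5⟩ :=
      exists_diam_sum_smul_ballSlice_lt (inrL1 X Y) hf hα hlam hdiam Iᶜ hIc (by linarith)
    exact (hY m f' α' lam' h1 h2 h3 h4).not_gt (h5.trans_le (min_le_right _ _))
end
end

section
/- Let X be a real Banach space and Y a closed subspace of X. If the quotient space X/Y is strongly regular and Y has the Ball Small Combination of Slices Property (BSCSP), then X has BSCSP. -/
open Metric Topology Pointwise ENNReal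

noncomputable section

/-- The slice of a bounded nonempty set `C` determined by `f` and `α`:
`{x ∈ C : f x > sup f(C) - α}`. -/
def setSlice {Z : Type*} [NormedAddCommGroup Z] [NormedSpace ℝ Z]
    (C : Set Z) (f : Z →L[ℝ] ℝ) (α : ℝ) : Set Z :=
  {x | x ∈ C ∧ sSup (f '' C) - α < f x}

/-- `Z` is strongly regular: every nonempty closed bounded convex subset has finite convex
combinations of slices of arbitrarily small diameter. -/
def StronglyRegular (Z : Type*) [NormedAddCommGroup Z] [NormedSpace ℝ Z] : Prop :=
  ∀ C : Set Z, C.Nonempty → IsClosed C → Bornology.IsBounded C → Convex ℝ C →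
    ∀ ε > (0 : ℝ), ∃ (n : ℕ) (f : Fin n → Z →L[ℝ] ℝ) (α lam : Fin n → ℝ),
      (∀ i, 0 < α i) ∧ (∀ i, 0 ≤ lam i) ∧ (∑ i, lam i = 1) ∧
      diam (∑ i, lam i • setSlice C (f i) (α i)) < ε

/-- `SliceComb C U` says that `U` contains an iterated convex combination of slices of `C`. -/
inductive SliceComb {Z : Type*} [NormedAddCommGroup Z] [NormedSpace ℝ Z] (C : Set Z) :
    Set Z → Prop
  | slice (f : Z →L[ℝ] ℝ) (α : ℝ) (hα : 0 < α) : SliceComb C (setSlice C f α)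
  | comb (n : ℕ) (lam : Fin n → ℝ) (K : Fin n → Set Z) (hK : ∀ i, SliceComb C (K i))
      (hlam : ∀ i, 0 ≤ lam i) (hsum : ∑ i, lam i = 1) : SliceComb C (∑ i, lam i • K i)
  | mono (K L : Set Z) (hK : SliceComb C K) (hKL : K ⊆ L) : SliceComb C L

lemma mem_sum_smul_set_iff {Z ι : Type*} [Fintype ι] [AddCommGroup Z] [Module ℝ Z]
    (lam : ι → ℝ) (K : ι → Set Z) (x : Z) :
    x ∈ ∑ i, lam i • K i ↔ ∃ k : ι → Z, (∀ i, k i ∈ K i) ∧ ∑ i, lam i • k i = x := by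
  rw [Set.mem_fintype_sum]
  constructor
  · rintro ⟨g, hg, rfl⟩
    choose k hk hkg using fun i => Set.mem_smul_set.1 (hg i)
    exact ⟨k, hk, Finset.sum_congr rfl fun i _ => hkg i⟩
  · rintro ⟨k, hk, rfl⟩
    exact ⟨fun i => lam i • k i, fun i => Set.smul_mem_smul_set (hk i), rfl⟩

lemma sum_smul_set_subset_of_convex {Z ι : Type*} [Fintype ι] [AddCommGroup Z] [Module ℝ Z]
    {C : Set Z} (hC : Convex ℝ C) {lam : ι → ℝ} (hlam : ∀ i, 0 ≤ lam i) (hsum : ∑ i, lam i = 1)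
    {K : ι → Set Z} (hK : ∀ i, K i ⊆ C) : ∑ i, lam i • K i ⊆ C := by
  intro x hx
  obtain ⟨k, hk, rfl⟩ := (mem_sum_smul_set_iff _ _ _).1 hx
  exact hC.sum_mem (fun i _ => hlam i) hsum fun i _ => hK i (hk i)

lemma sum_smul_set_mono {Z ι : Type*} [Fintype ι] [AddCommGroup Z] [Module ℝ Z]
    (lam : ι → ℝ) {K L : ι → Set Z} (h : ∀ i, K i ⊆ L i) :
    ∑ i, lam i • K i ⊆ ∑ i, lam i • L i := by
  intro x hx
  obtain ⟨k, hk, rfl⟩ := (mem_sum_smul_set_iff _ _ _).1 hx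
  exact (mem_sum_smul_set_iff _ _ _).2 ⟨k, fun i => h i (hk i), rfl⟩

section Slices

variable {Z : Type*} [NormedAddCommGroup Z] [NormedSpace ℝ Z] {C U : Set Z}

lemma bddAbove_image_of_isBounded (hC : Bornology.IsBounded C) (f : Z →L[ℝ] ℝ) :
    BddAbove (f '' C) :=
  (f.lipschitz.isBounded_image hC).bddAbove

lemma exists_mem_sSup_sub_lt (hne : C.Nonempty) (f : Z →L[ℝ] ℝ) {α : ℝ} (hα : 0 < α) :
    ∃ x ∈ C, sSup (f '' C) - α < f x := by
  obtain ⟨_, ⟨x, hx, rfl⟩, h⟩ :=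
    exists_lt_of_lt_csSup (hne.image f) (sub_lt_self (sSup (f '' C)) hα)
  exact ⟨x, hx, h⟩

lemma convex_setOf_mem_and_lt (hC : Convex ℝ C) (f : Z →L[ℝ] ℝ) (a : ℝ) :
    Convex ℝ {x | x ∈ C ∧ a < f x} :=
  hC.inter (convex_halfSpace_gt f.toLinearMap.isLinear a)

lemma SliceComb.nonempty (hne : C.Nonempty) (h : SliceComb C U) : U.Nonempty := by
  induction h with
  | slice f α hα => exact exists_mem_sSup_sub_lt hne f hα
  | comb n lam K hK hlam hsum ih =>
    choose k hk using ih
    exact ⟨_, (mem_sum_smul_set_iff _ _ _).2 ⟨k, hk, rfl⟩⟩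
  | mono K L hK hKL ih => exact ih.mono hKL

lemma SliceComb.inter_self (hC : Convex ℝ C) (h : SliceComb C U) : SliceComb C (U ∩ C) := by
  induction h with
  | slice f α hα => exact .mono _ _ (.slice f α hα) fun x hx => ⟨hx, hx.1⟩
  | comb n lam K hK hlam hsum ih =>
    exact .mono _ _ (.comb n lam _ ih hlam hsum) <| Set.subset_inter
      (sum_smul_set_mono _ fun i => Set.inter_subset_left)
      (sum_smul_set_subset_of_convex hC hlam hsum fun i => Set.inter_subset_right)
  | mono K L hK hKL ih => exact .mono _ _ ih (Set.inter_subset_inter_left _ hKL)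

lemma SliceComb.of_slices {S : Set Z}
    (hS : ∀ (f : Z →L[ℝ] ℝ) (α : ℝ), 0 < α → SliceComb C (setSlice S f α))
    (h : SliceComb S U) : SliceComb C U := by
  induction h with
  | slice f α hα => exact hS f α hα
  | comb n lam K hK hlam hsum ih => exact .comb n lam K ih hlam hsum
  | mono K L hK hKL ih => exact .mono _ _ ih hKL

lemma convex_setOf_sliceComb_preimage_ball {E : Type*} [NormedAddCommGroup E] [NormedSpace ℝ E]
    (C : Set Z) (T : Z →L[ℝ] E) (ε : ℝ) :
    Convex ℝ {e | SliceComb C (T ⁻¹' ball e ε)} := by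
  intro x hx y hy a b ha hb hab
  refine .mono _ _ (.comb 2 ![a, b] ![T ⁻¹' ball x ε, T ⁻¹' ball y ε] ?_ ?_ ?_) ?_
  · intro i; fin_cases i <;> assumption
  · intro i; fin_cases i <;> assumption
  · simpa using hab
  · intro z hz
    obtain ⟨k, hk, rfl⟩ := (mem_sum_smul_set_iff _ _ _).1 hz
    have h0 : dist (T (k 0)) x < ε := hk 0
    have h1 : dist (T (k 1)) y < ε := hk 1
    have key : a • (T (k 0) - x) + b • (T (k 1) - y) ∈ ball (0 : E) ε :=
      convex_ball (0 : E) ε (by simpa [dist_eq_norm] using h0)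
        (by simpa [dist_eq_norm] using h1) ha hb hab
    simp only [Set.mem_preimage, mem_ball, dist_eq_norm, Fin.sum_univ_two, map_add, map_smul,
      Matrix.cons_val_zero, Matrix.cons_val_one]
    rw [mem_ball_zero_iff] at key
    have heq : a • T (k 0) + b • T (k 1) - (a • x + b • y)
        = a • (T (k 0) - x) + b • (T (k 1) - y) := by module
    rwa [heq]

/-- If every slice of `C` along functionals factoring through `T` contains combinations of slices
with small image under `T`, then such combinations exist near every point of `C`. -/
lemma sliceComb_preimage_ball_of_slices {E : Type*} [NormedAddCommGroup E] [NormedSpace ℝ E]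
    (hC : Bornology.IsBounded C) (T : Z →L[ℝ] E)
    (h : ∀ (f : E →L[ℝ] ℝ) (α ε : ℝ), 0 < α → 0 < ε →
      ∃ e, SliceComb C (setSlice C (f.comp T) α ∩ T ⁻¹' ball e ε))
    {c : Z} (hc : c ∈ C) {ε : ℝ} (hε : 0 < ε) : SliceComb C (T ⁻¹' ball (T c) ε) := by
  set D : Set E := {e | SliceComb C (T ⁻¹' ball e (ε / 2))} with hD
  have hconv : Convex ℝ D := convex_setOf_sliceComb_preimage_ball C T (ε / 2)
  by_cases hcD : T c ∈ closure D
  · obtain ⟨e, he, hd⟩ := Metric.mem_closure_iff.1 hcD (ε / 2) (by positivity)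
    refine .mono _ _ he fun z hz => ?_
    have hz' : dist (T z) e < ε / 2 := hz
    have := dist_triangle_right (T z) (T c) e
    change dist (T z) (T c) < ε
    linarith
  · exfalso
    obtain ⟨f, u, hu, huc⟩ :=
      geometric_hahn_banach_closed_point hconv.closure isClosed_closure hcD
    have hsup : f (T c) ≤ sSup (f.comp T '' C) :=
      le_csSup (bddAbove_image_of_isBounded hC _) ⟨c, hc, rfl⟩
    set v := (u + f (T c)) / 2 with hv
    have hα : 0 < sSup (f.comp T '' C) - v := by linarith
    have hfpos : 0 < ‖f‖ + 1 := by positivity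
    have hε' : 0 < min (ε / 2) ((v - u) / (‖f‖ + 1)) :=
      lt_min (by positivity) (div_pos (by linarith) hfpos)
    obtain ⟨e, he⟩ := h f _ _ hα hε'
    have heD : e ∈ D := .mono _ _ he fun z hz =>
      ball_subset_ball (min_le_left _ _) hz.2
    obtain ⟨x, hx⟩ := he.nonempty ⟨c, hc⟩
    have h1 : v < f (T x) := by have := hx.1.2; simpa using this
    have h2 : dist (T x) e < (v - u) / (‖f‖ + 1) := lt_of_lt_of_le hx.2 (min_le_right _ _)
    have h3 := hu e (subset_closure heD)
    have h4 : f (T x) - f e ≤ ‖f‖ * dist (T x) e := by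
      rw [← map_sub, dist_eq_norm]
      exact (le_abs_self _).trans (f.le_opNorm _)
    rw [lt_div_iff₀ hfpos] at h2
    have := dist_nonneg (x := T x) (y := e)
    nlinarith

/-- Slices along functionals factoring through a Hilbert space contain slices with small image. -/
lemma exists_sliceComb_setSlice_inter_preimage_ball {E : Type*} [NormedAddCommGroup E]
    [InnerProductSpace ℝ E] (hne : C.Nonempty) (hC : Bornology.IsBounded C) (T : Z →L[ℝ] E)
    (f : E →L[ℝ] ℝ) {α ε : ℝ} (hα : 0 < α) (hε : 0 < ε) :
    ∃ e, SliceComb C (setSlice C (f.comp T) α ∩ T ⁻¹' ball e ε) := by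
  obtain ⟨M, hM⟩ : ∃ M, ∀ x ∈ C, ‖T x‖ ^ 2 ≤ M := by
    obtain ⟨r, hr⟩ := (T.lipschitz.isBounded_image hC).exists_norm_le
    exact ⟨r ^ 2, fun x hx => pow_le_pow_left₀ (norm_nonneg _) (hr _ ⟨x, hx, rfl⟩) 2⟩
  set s := sSup (f.comp T '' C) with hs
  have hfs : ∀ x ∈ C, f (T x) ≤ s := fun x hx =>
    le_csSup (bddAbove_image_of_isBounded hC (f.comp T)) ⟨x, hx, rfl⟩
  have hM0 : 0 ≤ M := by
    obtain ⟨x, hx⟩ := hne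
    exact (sq_nonneg _).trans (hM x hx)
  set η := ε ^ 2 / 4 with hη
  have hηpos : 0 < η := by positivity
  set R := (2 * η + M + 1) / (2 * α) with hR
  have hRpos : 0 < R := by positivity
  have hRα : 2 * R * α = 2 * η + M + 1 := by rw [hR]; field_simp
  set φ : Z → ℝ := fun x => ‖T x‖ ^ 2 + 2 * R * f (T x) with hφ
  have hbdd : BddAbove (φ '' C) := by
    refine ⟨M + 2 * R * s, ?_⟩
    rintro _ ⟨x, hx, rfl⟩
    have := mul_le_mul_of_nonneg_left (hfs x hx) (by positivity : 0 ≤ 2 * R)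
    have := hM x hx
    simp only [hφ]
    linarith
  set Φ := sSup (φ '' C) with hΦ
  have hφle : ∀ x ∈ C, φ x ≤ Φ := fun x hx => le_csSup hbdd ⟨x, hx, rfl⟩
  obtain ⟨_, ⟨c, hc, rfl⟩, hcφ⟩ :=
    exists_lt_of_lt_csSup (hne.image φ) (sub_lt_self (sSup (φ '' C)) hηpos)
  have hsΦ : 2 * R * s ≤ Φ := by
    rw [← le_div_iff₀' (by positivity)]
    refine csSup_le (hne.image _) ?_
    rintro _ ⟨x, hx, rfl⟩
    rw [le_div_iff₀' (by positivity)]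
    refine le_trans ?_ (hφle x hx)
    simp only [hφ, ContinuousLinearMap.comp_apply]
    have := sq_nonneg ‖T x‖
    linarith
  set g : Z →L[ℝ] ℝ := (innerSL ℝ (T c)).comp T + R • f.comp T with hg
  have hexp : ∀ x, φ x - φ c = ‖T x - T c‖ ^ 2 + 2 * (g x - g c) := by
    intro x
    simp only [hφ, hg, add_apply, ContinuousLinearMap.comp_apply,
      smul_apply, innerSL_apply_apply, smul_eq_mul, norm_sub_sq_real,
      real_inner_self_eq_norm_sq, real_inner_comm (T c) (T x)]
    ring
  have hgc : g c ≤ sSup (g '' C) := le_csSup (bddAbove_image_of_isBounded hC g) ⟨c, hc, rfl⟩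
  refine ⟨T c, .mono _ _ (.slice g (η / 2) (by positivity)) ?_⟩
  rintro x ⟨hxC, hx⟩
  have h1 := hexp x
  have h2 := hφle x hxC
  have h3 := sq_nonneg ‖T x - T c‖
  refine ⟨⟨hxC, ?_⟩, ?_⟩
  · change s - α < f (T x)
    have h4 : φ x = ‖T x‖ ^ 2 + 2 * R * f (T x) := rfl
    have h5 := hM x hxC
    by_contra hcon
    have := mul_le_mul_of_nonneg_left (not_lt.1 hcon) (by positivity : 0 ≤ 2 * R)
    linarith
  · change dist (T x) (T c) < ε
    rw [dist_eq_norm]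
    refine lt_of_pow_lt_pow_left₀ 2 hε.le ?_
    have : ε ^ 2 = 4 * η := by rw [hη]; ring
    linarith

/-- A version of Bourgain's lemma for the intersection of a convex set with two half-spaces. -/
lemma sliceComb_setOf_lt_and_lt (hconv : Convex ℝ C) (hC : Bornology.IsBounded C)
    {f g : Z →L[ℝ] ℝ} {a b : ℝ} {c : Z} (hc : c ∈ C) (ha : a < f c) (hb : b < g c) :
    SliceComb C {x | (x ∈ C ∧ a < f x) ∧ b < g x} := by
  set T : Z →L[ℝ] EuclideanSpace ℝ (Fin 2) :=
    (EuclideanSpace.equiv (Fin 2) ℝ).symm.toContinuousLinearMap.comp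
      (ContinuousLinearMap.pi ![f, g]) with hT
  have hT0 : ∀ x, T x 0 = f x := fun x => rfl
  have hT1 : ∀ x, T x 1 = g x := fun x => rfl
  have hε : 0 < min (f c - a) (g c - b) := lt_min (by linarith) (by linarith)
  have key := sliceComb_preimage_ball_of_slices hC T
    (fun f α ε hα hε => exists_sliceComb_setSlice_inter_preimage_ball ⟨c, hc⟩ hC T f hα hε) hc hε
  refine .mono _ _ (key.inter_self hconv) ?_
  rintro x ⟨hx, hxC⟩
  have hx' : ‖T x - T c‖ < min (f c - a) (g c - b) := by simpa [dist_eq_norm] using hx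
  have h0 : |f x - f c| ≤ ‖T x - T c‖ := PiLp.norm_apply_le (T x - T c) 0
  have h1 : |g x - g c| ≤ ‖T x - T c‖ := PiLp.norm_apply_le (T x - T c) 1
  have h2 := hx'.trans_le (min_le_left _ _)
  have h3 := hx'.trans_le (min_le_right _ _)
  have h4 := neg_abs_le (f x - f c)
  have h5 := neg_abs_le (g x - g c)
  exact ⟨⟨hxC, by linarith⟩, by linarith⟩

lemma sliceComb_setSlice_setOf_lt (hconv : Convex ℝ C) (hC : Bornology.IsBounded C)
    {f : Z →L[ℝ] ℝ} {a : ℝ} (hne : {x | x ∈ C ∧ a < f x}.Nonempty) (g : Z →L[ℝ] ℝ) {α : ℝ}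
    (hα : 0 < α) : SliceComb C (setSlice {x | x ∈ C ∧ a < f x} g α) := by
  obtain ⟨c, hc, hgc⟩ := exists_mem_sSup_sub_lt hne g hα
  exact sliceComb_setOf_lt_and_lt hconv hC hc.1 hc.2 hgc

lemma sliceComb_preimage_ball_of_stronglyRegular {Q : Type*} [NormedAddCommGroup Q]
    [NormedSpace ℝ Q] (hQ : StronglyRegular Q) (hconv : Convex ℝ C)
    (hC : Bornology.IsBounded C) (T : Z →L[ℝ] Q) {c : Z} (hc : c ∈ C) {ε : ℝ} (hε : 0 < ε) :
    SliceComb C (T ⁻¹' ball (T c) ε) := by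
  refine sliceComb_preimage_ball_of_slices hC T (fun f α ε hα hε => ?_) hc hε
  set S := setSlice C (f.comp T) α with hS
  have hSne : S.Nonempty := exists_mem_sSup_sub_lt ⟨c, hc⟩ _ hα
  have hSconv : Convex ℝ S := convex_setOf_mem_and_lt hconv _ _
  have hSbdd : Bornology.IsBounded S := hC.subset fun x hx => hx.1
  set D := closure (T '' S) with hD
  have hDbdd : Bornology.IsBounded D := (T.lipschitz.isBounded_image hSbdd).closure
  have hDconv : Convex ℝ D := (hSconv.linear_image T.toLinearMap).closure
  obtain ⟨n, g, β, lam, hβ, hlam, hsum, hdiam⟩ :=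
    hQ D (hSne.image T).closure isClosed_closure hDbdd hDconv ε hε
  have hsup : ∀ i, sSup (g i '' D) ≤ sSup ((g i).comp T '' S) := by
    intro i
    refine csSup_le ((hSne.image T).closure.image _) ?_
    rintro _ ⟨d, hd, rfl⟩
    have hcl : IsClosed {z | g i z ≤ sSup ((g i).comp T '' S)} :=
      isClosed_le (g i).continuous continuous_const
    refine closure_minimal ?_ hcl hd
    rintro _ ⟨x, hx, rfl⟩
    exact le_csSup (bddAbove_image_of_isBounded hSbdd ((g i).comp T)) ⟨x, hx, rfl⟩
  have hV : SliceComb S (∑ i, lam i • setSlice S ((g i).comp T) (β i)) :=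
    .comb n lam _ (fun i => .slice _ _ (hβ i)) hlam hsum
  have hVS : ∑ i, lam i • setSlice S ((g i).comp T) (β i) ⊆ S :=
    sum_smul_set_subset_of_convex hSconv hlam hsum fun i x hx => hx.1
  have hmaps : ∀ x ∈ ∑ i, lam i • setSlice S ((g i).comp T) (β i),
      T x ∈ ∑ i, lam i • setSlice D (g i) (β i) := by
    intro x hx
    obtain ⟨k, hk, rfl⟩ := (mem_sum_smul_set_iff _ _ _).1 hx
    refine (mem_sum_smul_set_iff _ _ _).2 ⟨fun i => T (k i), fun i => ⟨?_, ?_⟩, by simp⟩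
    · exact subset_closure ⟨k i, (hk i).1, rfl⟩
    · exact (sub_le_sub_right (hsup i) _).trans_lt (hk i).2
  have hWbdd : Bornology.IsBounded (∑ i, lam i • setSlice D (g i) (β i)) :=
    hDbdd.subset (sum_smul_set_subset_of_convex hDconv hlam hsum fun i x hx => hx.1)
  obtain ⟨x₀, hx₀⟩ := hV.nonempty hSne
  refine ⟨T x₀, .mono _ _ (hV.of_slices fun g α hα =>
    sliceComb_setSlice_setOf_lt hconv hC hSne g hα) fun x hx => ⟨hVS hx, ?_⟩⟩
  exact (dist_le_diam_of_mem hWbdd (hmaps x hx) (hmaps x₀ hx₀)).trans_lt hdiam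

lemma exists_ballSlice_subset_setSlice {f₀ : Z →L[ℝ] ℝ} (hf₀ : ‖f₀‖ = 1) (f : Z →L[ℝ] ℝ) {α : ℝ}
    (hα : 0 < α) : ∃ (g : Z →L[ℝ] ℝ) (β : ℝ), ‖g‖ = 1 ∧ 0 < β ∧
      ballSlice Z g β ⊆ setSlice (closedBall 0 1) f α := by
  have hsup : sSup (f '' closedBall 0 1) ≤ ‖f‖ := by
    refine csSup_le ((nonempty_closedBall.2 zero_le_one).image _) ?_
    rintro _ ⟨x, hx, rfl⟩
    rw [mem_closedBall_zero_iff] at hx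
    exact (le_abs_self _).trans (f.unit_le_opNorm x hx)
  by_cases hf : f = 0
  · subst hf
    refine ⟨f₀, 1, hf₀, one_pos, fun x hx => ⟨hx.1, ?_⟩⟩
    rw [norm_zero] at hsup
    rw [zero_apply]
    linarith
  · have hpos : 0 < ‖f‖ := norm_pos_iff.2 hf
    refine ⟨‖f‖⁻¹ • f, ‖f‖⁻¹ * α, ?_, by positivity, fun x hx => ⟨hx.1, ?_⟩⟩
    · rw [norm_smul, norm_inv, norm_norm, inv_mul_cancel₀ hpos.ne']
    · have h := hx.2
      simp only [smul_apply, smul_eq_mul] at h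
      have h' := mul_lt_mul_of_pos_left h hpos
      rw [mul_sub, mul_one, mul_inv_cancel_left₀ hpos.ne', mul_inv_cancel_left₀ hpos.ne'] at h'
      linarith

lemma SliceComb.exists_fintype_ballSlice {f₀ : Z →L[ℝ] ℝ} (hf₀ : ‖f₀‖ = 1)
    (h : SliceComb (closedBall (0 : Z) 1) U) :
    ∃ (ι : Type) (_ : Fintype ι) (f : ι → Z →L[ℝ] ℝ) (α lam : ι → ℝ),
      (∀ i, ‖f i‖ = 1) ∧ (∀ i, 0 < α i) ∧ (∀ i, 0 ≤ lam i) ∧ (∑ i, lam i = 1) ∧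
      ∑ i, lam i • ballSlice Z (f i) (α i) ⊆ U := by
  induction h with
  | slice f α hα =>
    obtain ⟨g, β, hg, hβ, hsub⟩ := exists_ballSlice_subset_setSlice hf₀ f hα
    exact ⟨Unit, inferInstance, fun _ => g, fun _ => β, fun _ => 1, fun _ => hg, fun _ => hβ,
      fun _ => zero_le_one, by simp, by simpa using hsub⟩
  | comb n lam K hK hlam hsum ih =>
    choose ι inst f α mu hf hα hmu hmusum hsub using ih
    refine ⟨Σ i, ι i, inferInstance, fun p => f p.1 p.2, fun p => α p.1 p.2,
      fun p => lam p.1 * mu p.1 p.2, fun p => hf _ _, fun p => hα _ _,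
      fun p => mul_nonneg (hlam _) (hmu _ _), ?_, ?_⟩
    · simp [Fintype.sum_sigma, ← Finset.mul_sum, hmusum, hsum]
    · rw [Fintype.sum_sigma]
      simp only [mul_smul, ← Finset.smul_sum]
      exact sum_smul_set_mono lam hsub
  | mono K L hK hKL ih =>
    obtain ⟨ι, inst, f, α, lam, h1, h2, h3, h4, h5⟩ := ih
    exact ⟨ι, inst, f, α, lam, h1, h2, h3, h4, h5.trans hKL⟩

lemma SliceComb.exists_ballSlice {f₀ : Z →L[ℝ] ℝ} (hf₀ : ‖f₀‖ = 1)
    (h : SliceComb (closedBall (0 : Z) 1) U) :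
    ∃ (n : ℕ) (f : Fin n → Z →L[ℝ] ℝ) (α lam : Fin n → ℝ),
      (∀ i, ‖f i‖ = 1) ∧ (∀ i, 0 < α i) ∧ (∀ i, 0 ≤ lam i) ∧ (∑ i, lam i = 1) ∧
      ∑ i, lam i • ballSlice Z (f i) (α i) ⊆ U := by
  obtain ⟨ι, _, f, α, lam, h1, h2, h3, h4, h5⟩ := h.exists_fintype_ballSlice hf₀
  let e := (Fintype.equivFin ι).symm
  refine ⟨Fintype.card ι, f ∘ e, α ∘ e, lam ∘ e, fun i => h1 _, fun i => h2 _, fun i => h3 _,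
    (e.sum_comp lam).trans h4, ?_⟩
  exact (e.sum_comp fun i => lam i • ballSlice Z (f i) (α i)).trans_subset h5

end Slices

/-- A point of the unit ball which is close to `Y` in the quotient norm is close to a point of the
unit ball of `Y`. -/
lemma exists_mem_closedBall_submodule_dist_lt {X : Type*} [NormedAddCommGroup X]
    [NormedSpace ℝ X] (Y : Submodule ℝ X) {x : X} (hx : ‖x‖ ≤ 1) {ε : ℝ}
    (hxε : ‖Submodule.Quotient.mk (p := Y) x‖ < ε) : ∃ y : Y, ‖y‖ ≤ 1 ∧ ‖x - y‖ < 2 * ε := by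
  have hε : 0 < ε := (norm_nonneg _).trans_lt hxε
  obtain ⟨m, hm, hmε⟩ := (QuotientAddGroup.norm_lt_iff (S := Y.toAddSubgroup)).1 hxε
  have hmem : x - m ∈ Y := by
    have := (Submodule.Quotient.eq Y).1 (show Submodule.Quotient.mk x = Submodule.Quotient.mk m
      from hm.symm)
    exact this
  have hnorm : ‖x - m‖ ≤ 1 + ε := (norm_sub_le _ _).trans (by linarith)
  have hpos : 0 < 1 + ε := by linarith
  refine ⟨(1 + ε)⁻¹ • ⟨x - m, hmem⟩, ?_, ?_⟩
  · rw [norm_smul, Real.norm_of_nonneg (by positivity), inv_mul_le_iff₀ hpos, mul_one]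
    exact hnorm
  · have heq : x - (((1 + ε)⁻¹ • ⟨x - m, hmem⟩ : Y) : X) = m + (ε * (1 + ε)⁻¹) • (x - m) := by
      have : ε * (1 + ε)⁻¹ = 1 - (1 + ε)⁻¹ := by field_simp; ring
      rw [this, Submodule.coe_smul]
      module
    rw [heq]
    refine (norm_add_le _ _).trans_lt ?_
    have : ‖(ε * (1 + ε)⁻¹) • (x - m)‖ ≤ ε := by
      rw [norm_smul, Real.norm_of_nonneg (by positivity), mul_assoc]
      refine mul_le_of_le_one_right hε.le ?_
      rwa [inv_mul_le_iff₀ hpos, mul_one]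
    linarith

/-- If `Y` is a closed subspace of a Banach space `X` such that `X/Y` is strongly regular
and `Y` has `BSCSP`, then `X` has `BSCSP`. -/
theorem statement19 (X : Type*) [NormedAddCommGroup X] [NormedSpace ℝ X] [CompleteSpace X]
    (Y : Submodule ℝ X) [IsClosed (Y : Set X)]
    (hq : StronglyRegular (X ⧸ Y)) (hY : BSCSP Y) :
    BSCSP X := by
  intro ε hε
  obtain ⟨n, f, α, lam, hf, hα, hlam, hsum, hdiam⟩ := hY (ε / 2) (by positivity)
  choose F hF hFnorm using fun i => exists_extension_norm_eq Y (f i)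
  have hF1 : ∀ i, ‖F i‖ = 1 := fun i => (hFnorm i).trans (hf i)
  obtain ⟨i₀⟩ : Nonempty (Fin n) := by
    by_contra hn
    rw [not_nonempty_iff] at hn
    simp at hsum
  set δ : Fin n → ℝ := fun i => min (α i / 4) (ε / 16) with hδ
  have hδpos : ∀ i, 0 < δ i := fun i => lt_min (by linarith [hα i]) (by positivity)
  set S : Fin n → Set X := fun i => ballSlice X (F i) (α i / 2) with hS
  have hball : Convex ℝ (closedBall (0 : X) 1) := convex_closedBall 0 1
  have hU : ∀ i, SliceComb (closedBall (0 : X) 1) (Y.mkQL ⁻¹' ball 0 (δ i) ∩ S i) := by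
    intro i
    obtain ⟨y, hy, hfy⟩ := ballSlice_nonempty (hf i) (half_pos (hα i))
    have hyS : (y : X) ∈ S i := ⟨by simpa using hy, by rw [hF i]; exact hfy⟩
    have hSconv : Convex ℝ (S i) := convex_setOf_mem_and_lt hball _ _
    have key := sliceComb_preimage_ball_of_stronglyRegular hq hSconv
      (isBounded_closedBall.subset fun x hx => hx.1) Y.mkQL hyS (hδpos i)
    have hy0 : Y.mkQL (y : X) = 0 := (Submodule.Quotient.mk_eq_zero Y).2 y.2
    rw [hy0] at key
    exact (key.inter_self hSconv).of_slices fun g β hβ =>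
      sliceComb_setSlice_setOf_lt hball isBounded_closedBall ⟨_, hyS⟩ g hβ
  obtain ⟨m, g, β, mu, hg, hβ, hmu, hmusum, hsub⟩ :=
    (SliceComb.comb n lam _ hU hlam hsum).exists_ballSlice (hF1 i₀)
  refine ⟨m, g, β, mu, hg, hβ, hmu, hmusum, ?_⟩
  have hnear : ∀ x ∈ ∑ i, mu i • ballSlice X (g i) (β i),
      ∃ y ∈ ∑ i, lam i • ballSlice Y (f i) (α i), ‖x - (y : X)‖ ≤ ε / 8 := by
    intro x hx
    obtain ⟨k, hk, rfl⟩ := (mem_sum_smul_set_iff _ _ _).1 (hsub hx)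
    have hk' : ∀ i, ∃ y ∈ ballSlice Y (f i) (α i), ‖k i - (y : X)‖ ≤ ε / 8 := by
      intro i
      obtain ⟨hki, hkS⟩ := hk i
      have hk1 : ‖k i‖ ≤ 1 := by simpa using hkS.1
      obtain ⟨y, hy1, hyd⟩ := exists_mem_closedBall_submodule_dist_lt Y hk1
        (mem_ball_zero_iff.1 hki)
      have h1 : δ i ≤ α i / 4 := min_le_left _ _
      have h2 : δ i ≤ ε / 16 := min_le_right _ _
      refine ⟨y, ⟨by simpa using hy1, ?_⟩, by linarith⟩
      have h3 : F i (k i) - f i y ≤ ‖k i - (y : X)‖ := by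
        rw [← hF i, ← map_sub]
        simpa [hF1 i] using (le_abs_self _).trans ((F i).le_opNorm (k i - (y : X)))
      have h4 : 1 - α i / 2 < F i (k i) := hkS.2
      linarith
    choose y hy hyd using hk'
    refine ⟨∑ i, lam i • y i, (mem_sum_smul_set_iff _ _ _).2 ⟨y, hy, rfl⟩, ?_⟩
    have hmem : ∑ i, lam i • (k i - (y i : X)) ∈ closedBall (0 : X) (ε / 8) :=
      (convex_closedBall 0 _).sum_mem (fun i _ => hlam i) hsum fun i _ => by simpa using hyd i
    simpa [smul_sub, Finset.sum_sub_distrib] using hmem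
  have hbdd : Bornology.IsBounded (∑ i, lam i • ballSlice Y (f i) (α i)) :=
    isBounded_closedBall.subset
      (sum_smul_set_subset_of_convex (convex_closedBall (0 : Y) 1) hlam hsum fun i x hx => hx.1)
  refine (diam_le_of_forall_dist_le (C := ε / 2 + ε / 4) (by positivity) ?_).trans_lt
    (by linarith)
  intro x hx x' hx'
  obtain ⟨y, hy, hxy⟩ := hnear x hx
  obtain ⟨y', hy', hxy'⟩ := hnear x' hx'
  have h1 : dist (y : X) y' < ε / 2 := (dist_le_diam_of_mem hbdd hy hy').trans_lt hdiam
  have h2 := dist_triangle4 x (y : X) y' x'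
  rw [← dist_eq_norm] at hxy hxy'
  rw [dist_comm (y' : X) x'] at h2
  linarith
end
end
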